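/- Let (Ω, F, P) be a probability space and let A_1, ..., A_N be events with P(A_i) = p_i. Then for every integer M with 1 ≤ M ≤ N, the probability of the set of ω that belong to at least M of the events A_1, ..., A_N is at least (Σ_{i=1}^N p_i − M + 1)/(N − M + 1). -/

import Mathlib

open MeasureTheory Finset
open scoped Classical ENNReal

/-- The number of sets of a finite family containing a point is a sum of indicators. -/
theorem card_filter_mem_eq_sum_indicator {Ω ι : Type*} [Fintype ι] (A : ι → Set Ω) (ω : Ω) :
    ((Finset.univ.filter (fun i => ω ∈ A i)).card : ℝ) =
      ∑ i, (A i).indicator (fun _ => (1 : ℝ)) ω := by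
  simp [Set.indicator_apply]

theorem measurableSet_le_card_filter_mem {Ω ι : Type*} [MeasurableSpace Ω] [Fintype ι]
    {A : ι → Set Ω} (hA : ∀ i, MeasurableSet (A i)) (M : ℕ) :
    MeasurableSet {ω | M ≤ (Finset.univ.filter (fun i => ω ∈ A i)).card} := by
  have h : Measurable fun ω => ∑ i, (A i).indicator (fun _ => (1 : ℝ)) ω :=
    Finset.measurable_fun_sum _ fun i _ => measurable_const.indicator (hA i)
  have hM : MeasurableSet {ω | (M : ℝ) ≤ ∑ i, (A i).indicator (fun _ => (1 : ℝ)) ω} :=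
    measurableSet_le measurable_const h
  simpa only [← card_filter_mem_eq_sum_indicator, Nat.cast_le] using hM

/-- Hairer's Borel-Cantelli lemma, lower bound: the probability that at least `M` of the
events `A 1, ..., A N` happen simultaneously is at least `(∑ i, p i - M + 1) / (N - M + 1)`. -/
theorem hairer_borel_cantelli_lower
    {Ω : Type*} [MeasurableSpace Ω] (P : Measure Ω) [IsProbabilityMeasure P]
    (N : ℕ) (A : Fin N → Set Ω) (hA : ∀ i, MeasurableSet (A i))
    (p : Fin N → ℝ) (hp : ∀ i, (P (A i)).toReal = p i)
    (M : ℕ) (hM1 : 1 ≤ M) (hMN : M ≤ N) :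
    ((∑ i, p i) - M + 1) / ((N : ℝ) - M + 1) ≤
      (P {ω | M ≤ (Finset.univ.filter (fun i => ω ∈ A i)).card}).toReal := by
  have hM : (1 : ℝ) ≤ M := by exact_mod_cast hM1
  have hN : (M : ℝ) ≤ N := by exact_mod_cast hMN
  rw [div_le_iff₀ (by linarith)]
  set S := {ω | M ≤ (Finset.univ.filter (fun i => ω ∈ A i)).card}
  have hSm : MeasurableSet S := measurableSet_le_card_filter_mem hA M
  have hint : ∀ {B : Set Ω}, MeasurableSet B →
      Integrable (B.indicator fun _ => (1 : ℝ)) P :=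
    fun hB => (integrable_const 1).indicator hB
  have hval : ∀ {B : Set Ω}, MeasurableSet B →
      ∫ ω, B.indicator (fun _ => (1 : ℝ)) ω ∂P = (P B).toReal := fun hB => by
    rw [integral_indicator_const _ hB, smul_eq_mul, mul_one, measureReal_def]
  have hpt : ∀ ω, ∑ i, (A i).indicator (fun _ => (1 : ℝ)) ω ≤
      ((M : ℝ) - 1) + ((N : ℝ) - M + 1) * S.indicator (fun _ => (1 : ℝ)) ω := by
    intro ω
    rw [← card_filter_mem_eq_sum_indicator]
    by_cases hω : ω ∈ S
    · have hcard : (Finset.univ.filter (fun i => ω ∈ A i)).card ≤ N := by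
        simpa using Finset.card_filter_le (Finset.univ : Finset (Fin N)) (fun i => ω ∈ A i)
      have hcard' : ((Finset.univ.filter (fun i => ω ∈ A i)).card : ℝ) ≤ N := by
        exact_mod_cast hcard
      rw [Set.indicator_of_mem hω]
      linarith
    · have hcard : (Finset.univ.filter (fun i => ω ∈ A i)).card + 1 ≤ M :=
        Nat.succ_le_of_lt (not_le.mp hω)
      have hcard' : ((Finset.univ.filter (fun i => ω ∈ A i)).card : ℝ) + 1 ≤ M := by
        exact_mod_cast hcard
      rw [Set.indicator_of_notMem hω]
      linarith
  have hle := integral_mono (μ := P) (integrable_finsetSum _ fun i _ => hint (hA i))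
    ((integrable_const _).add ((hint hSm).const_mul _)) hpt
  rw [integral_finsetSum _ fun i _ => hint (hA i),
    integral_add' (integrable_const _) ((hint hSm).const_mul _), integral_const_mul,
    hval hSm] at hle
  simp only [hval (hA _), hp, integral_const, probReal_univ, one_smul] at hle
  linarith
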